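/- arXiv:2211.01357 — 2 statements merged into one kernel-verified Lean document; each statement's English description precedes it below -/
import Mathlib

section
/- Assume ‖g_s‖ ≤ B for all 1 ≤ s ≤ T. Then for every sequence of points y_1,…,y_T ∈ int B(1): Σ_{t=1}^T g_tᵀ (∇²Φ_t(y_t))⁻¹ g_t ≤ (d/β)·ln(d + T·B²/d). -/
open Finset
open scoped InnerProductSpace

noncomputable section

/-- `Ψ(x) = −ηd·ln(1−‖x‖²)`, the scaled log-barrier of the Euclidean unit ball. -/
def Psi (d : ℕ) (η : ℝ) (x : EuclideanSpace ℝ (Fin d)) : ℝ :=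
  -(η * d) * Real.log (1 - ‖x‖ ^ 2)

/-- The outer product `v wᵀ` of two vectors in `ℝ^d`. -/
def outer {d : ℕ} (v w : EuclideanSpace ℝ (Fin d)) : Matrix (Fin d) (Fin d) ℝ :=
  fun i j => v i * w j

/-- The Hessian of `Ψ`: `∇²Ψ(x) = 2ηd·( I/(1−‖x‖²) + 2xxᵀ/(1−‖x‖²)² )`. -/
def hessPsi (d : ℕ) (η : ℝ) (x : EuclideanSpace ℝ (Fin d)) : Matrix (Fin d) (Fin d) ℝ :=
  (2 * η * d / (1 - ‖x‖ ^ 2)) • (1 : Matrix (Fin d) (Fin d) ℝ)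
    + (4 * η * d / (1 - ‖x‖ ^ 2) ^ 2) • outer x x

/-- `Φ_t(x) = Ψ(x) + ((d+B²η)/2)‖x‖² + (β/2)·Σ_{s=1}^{t−1}⟪g_s, x−w_s⟫² + ⟪x, Σ_{s=1}^{t−1} g_s⟫`. -/
def Phi (d : ℕ) (η β B : ℝ) (g w : ℕ → EuclideanSpace ℝ (Fin d)) (t : ℕ)
    (x : EuclideanSpace ℝ (Fin d)) : ℝ :=
  Psi d η x + ((d + B ^ 2 * η) / 2) * ‖x‖ ^ 2
    + (β / 2) * ∑ s ∈ Icc 1 (t - 1), ⟪g s, x - w s⟫_ℝ ^ 2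
    + ⟪x, (∑ s ∈ Icc 1 (t - 1), g s)⟫_ℝ

/-- The Hessian of `Φ_t`:
`∇²Φ_t(x) = (2ηd/(1−‖x‖²))I + (4ηd/(1−‖x‖²)²)xxᵀ + (d+ηB²)I + β·Σ_{s=1}^{t−1} g_s g_sᵀ`. -/
def hessPhi (d : ℕ) (η β B : ℝ) (g : ℕ → EuclideanSpace ℝ (Fin d)) (t : ℕ)
    (x : EuclideanSpace ℝ (Fin d)) : Matrix (Fin d) (Fin d) ℝ :=
  hessPsi d η x + ((d : ℝ) + η * B ^ 2) • (1 : Matrix (Fin d) (Fin d) ℝ)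
    + β • ∑ s ∈ Icc 1 (t - 1), outer (g s) (g s)

/-- The quadratic form `vᵀ M v`. -/
def qf {d : ℕ} (M : Matrix (Fin d) (Fin d) ℝ) (v : EuclideanSpace ℝ (Fin d)) : ℝ :=
  ∑ i, ∑ j, v i * M i j * v j

open Matrix

lemma qf_eq_dotProduct {d : ℕ} (M : Matrix (Fin d) (Fin d) ℝ) (v : EuclideanSpace ℝ (Fin d)) :
    qf M v = v.ofLp ⬝ᵥ (M *ᵥ v.ofLp) := by
  simp only [qf, dotProduct, mulVec, Finset.mul_sum, mul_assoc]

lemma outer_eq_vecMulVec {d : ℕ} (v w : EuclideanSpace ℝ (Fin d)) :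
    outer v w = vecMulVec v.ofLp w.ofLp := rfl

lemma dotProduct_self_eq_norm_sq {d : ℕ} (v : EuclideanSpace ℝ (Fin d)) :
    v.ofLp ⬝ᵥ v.ofLp = ‖v‖ ^ 2 := by
  rw [EuclideanSpace.real_norm_sq_eq]
  simp only [dotProduct, sq]

lemma posSemidef_outer_self {d : ℕ} (v : EuclideanSpace ℝ (Fin d)) :
    (outer v v).PosSemidef := by
  simpa [outer_eq_vecMulVec] using posSemidef_vecMulVec_self_star v.ofLp

lemma posSemidef_smul_one_sub_smul_outer {d : ℕ} (v : EuclideanSpace ℝ (Fin d)) {a b : ℝ}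
    (hb : 0 ≤ b) (hab : b * ‖v‖ ^ 2 ≤ a) :
    (a • (1 : Matrix (Fin d) (Fin d) ℝ) - b • outer v v).PosSemidef := by
  refine .of_dotProduct_mulVec_nonneg ?_ fun x => ?_
  · have h₁ := (PosSemidef.one (n := Fin d) (R := ℝ)).isHermitian
    have h₂ := (posSemidef_outer_self v).isHermitian
    simp only [IsHermitian, conjTranspose_sub, conjTranspose_smul, h₁.eq, h₂.eq, star_trivial]
  · have hcs : (x ⬝ᵥ v.ofLp) ^ 2 ≤ (x ⬝ᵥ x) * ‖v‖ ^ 2 := by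
      rw [← dotProduct_self_eq_norm_sq]
      simpa [dotProduct, sq] using Finset.sum_mul_sq_le_sq_mul_sq Finset.univ x v.ofLp
    have hx : 0 ≤ x ⬝ᵥ x := Finset.sum_nonneg fun i _ => mul_self_nonneg _
    have key : star x ⬝ᵥ ((a • (1 : Matrix (Fin d) (Fin d) ℝ) - b • outer v v) *ᵥ x)
        = a * (x ⬝ᵥ x) - b * (x ⬝ᵥ v.ofLp) ^ 2 := by
      simp only [star_trivial, sub_mulVec, smul_mulVec, one_mulVec, dotProduct_sub,
        dotProduct_smul, outer_eq_vecMulVec, vecMulVec_mulVec, smul_eq_mul, op_smul_eq_smul]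
      rw [dotProduct_comm v.ofLp x]
      ring
    rw [key]
    nlinarith [mul_le_mul_of_nonneg_left hcs hb, mul_le_mul_of_nonneg_right hab hx]

/-- Inversion reverses the Loewner order on positive definite matrices. -/
lemma dotProduct_inv_mulVec_le {n : Type*} [Fintype n] [DecidableEq n] {H M : Matrix n n ℝ}
    (hM : M.PosDef) (hHM : (H - M).PosSemidef) (v : n → ℝ) :
    v ⬝ᵥ (H⁻¹ *ᵥ v) ≤ v ⬝ᵥ (M⁻¹ *ᵥ v) := by
  have hH : H.PosDef := by simpa using hM.add_posSemidef hHM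
  set u := H⁻¹ *ᵥ v with hu
  set z := M⁻¹ *ᵥ v with hz
  have hHu : H *ᵥ u = v := by
    rw [hu, mulVec_mulVec, mul_nonsing_inv _ ((isUnit_iff_isUnit_det _).mp hH.isUnit), one_mulVec]
  have hMz : M *ᵥ z = v := by
    rw [hz, mulVec_mulVec, mul_nonsing_inv _ ((isUnit_iff_isUnit_det _).mp hM.isUnit), one_mulVec]
  have h₁ := hM.posSemidef.dotProduct_mulVec_nonneg (u - z)
  have h₂ := hHM.dotProduct_mulVec_nonneg u
  have hzu : z ⬝ᵥ (M *ᵥ u) = v ⬝ᵥ u := by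
    have hMT : Mᵀ = M := by simpa [IsHermitian] using hM.isHermitian
    rw [dotProduct_mulVec, ← mulVec_transpose, hMT, hMz]
  simp only [star_trivial, mulVec_sub, sub_mulVec, dotProduct_sub, sub_dotProduct, hMz, hHu,
    hzu] at h₁ h₂
  rw [dotProduct_comm u v, dotProduct_comm z v] at *
  linarith

lemma det_sub_smul_vecMulVec {n : Type*} [Fintype n] [DecidableEq n] {M : Matrix n n ℝ}
    (hM : IsUnit M.det) (b : ℝ) (v : n → ℝ) :
    (M - b • vecMulVec v v).det = M.det * (1 - b * (v ⬝ᵥ (M⁻¹ *ᵥ v))) := by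
  have h := det_add_replicateCol_mul_replicateRow (ι := Unit) hM ((-b) • v) v
  rw [← vecMulVec_eq, smul_vecMulVec, replicateCol_smul, neg_smul, neg_smul,
    ← sub_eq_add_neg] at h
  rw [h, det_unique (n := Unit), Matrix.mul_assoc]
  simp only [Matrix.mul_neg, Matrix.mul_smul, Matrix.add_apply, Matrix.neg_apply,
    Matrix.smul_apply, ← replicateCol_mulVec, one_apply_eq, smul_eq_mul, replicateCol_apply]
  rw [sub_eq_add_neg]
  rfl

/-- Each rank-one update is paid for by the growth of the log-determinant. -/
lemma mul_dotProduct_inv_mulVec_le_log_det_sub {n : Type*} [Fintype n] [DecidableEq n]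
    {M : Matrix n n ℝ} {b : ℝ} {v : n → ℝ} (hM : M.PosDef)
    (hN : (M - b • vecMulVec v v).PosDef) :
    b * (v ⬝ᵥ (M⁻¹ *ᵥ v)) ≤
      Real.log M.det - Real.log (M - b • vecMulVec v v).det := by
  have hdet := det_sub_smul_vecMulVec hM.det_pos.ne'.isUnit b v
  have hpos : 0 < 1 - b * (v ⬝ᵥ (M⁻¹ *ᵥ v)) :=
    pos_of_mul_pos_right (hdet ▸ hN.det_pos) hM.det_pos.le
  rw [hdet, Real.log_mul hM.det_pos.ne' hpos.ne']
  linarith [Real.log_le_sub_one_of_pos hpos]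

lemma log_det_le_of_trace_le {n : Type*} [Fintype n] [DecidableEq n] {M : Matrix n n ℝ}
    (hM : M.PosDef) {a : ℝ} (ha : 0 < a) (htr : M.trace ≤ Fintype.card n * a) :
    Real.log M.det ≤ Fintype.card n * Real.log a := by
  have htr' : M.trace = ∑ i, hM.1.eigenvalues i := by
    simpa using hM.1.trace_eq_sum_eigenvalues
  have hdet : M.det = ∏ i, hM.1.eigenvalues i := by
    simpa using hM.1.det_eq_prod_eigenvalues
  rw [hdet, Real.log_prod fun i _ => (hM.eigenvalues_pos i).ne']
  calc ∑ i, Real.log (hM.1.eigenvalues i)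
      ≤ ∑ i, (hM.1.eigenvalues i / a - 1 + Real.log a) := by
        refine Finset.sum_le_sum fun i _ => ?_
        have h := Real.log_le_sub_one_of_pos (div_pos (hM.eigenvalues_pos i) ha)
        rw [Real.log_div (hM.eigenvalues_pos i).ne' ha.ne'] at h
        linarith
    _ = M.trace / a - Fintype.card n + Fintype.card n * Real.log a := by
        simp [Finset.sum_add_distrib, ← Finset.sum_div, htr']
    _ ≤ Fintype.card n * Real.log a := by
        linarith [(div_le_iff₀ ha).mpr htr]

/-- The regularized Gram matrix `dI + β·Σ_{s=1}^t g_s g_sᵀ`. -/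
def regGram (d : ℕ) (β : ℝ) (g : ℕ → EuclideanSpace ℝ (Fin d)) (t : ℕ) :
    Matrix (Fin d) (Fin d) ℝ :=
  (d : ℝ) • (1 : Matrix (Fin d) (Fin d) ℝ) + β • ∑ s ∈ Icc 1 t, outer (g s) (g s)

lemma regGram_zero (d : ℕ) (β : ℝ) (g : ℕ → EuclideanSpace ℝ (Fin d)) :
    regGram d β g 0 = (d : ℝ) • (1 : Matrix (Fin d) (Fin d) ℝ) := by
  simp [regGram]

lemma regGram_succ (d : ℕ) (β : ℝ) (g : ℕ → EuclideanSpace ℝ (Fin d)) (t : ℕ) :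
    regGram d β g (t + 1) = regGram d β g t + β • outer (g (t + 1)) (g (t + 1)) := by
  simp [regGram, Finset.sum_Icc_succ_top, smul_add, add_assoc]

lemma posDef_regGram {d : ℕ} (hd : 1 ≤ d) {β : ℝ} (hβ : 0 ≤ β)
    (g : ℕ → EuclideanSpace ℝ (Fin d)) (t : ℕ) : (regGram d β g t).PosDef :=
  (PosDef.one.smul (by exact_mod_cast hd : (0 : ℝ) < d)).add_posSemidef
    ((posSemidef_sum _ fun s _ => posSemidef_outer_self (g s)).smul hβ)

lemma trace_regGram {d : ℕ} (β : ℝ) (g : ℕ → EuclideanSpace ℝ (Fin d)) (t : ℕ) :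
    (regGram d β g t).trace = d * d + β * ∑ s ∈ Icc 1 t, ‖g s‖ ^ 2 := by
  simp [regGram, trace_sum, outer_eq_vecMulVec, trace_vecMulVec, dotProduct_self_eq_norm_sq]

lemma posSemidef_hessPhi_sub_regGram {d : ℕ} {η β B : ℝ} (hη : 1 ≤ η)
    (hβ : β ∈ Set.Ioo (0 : ℝ) 1) {g : ℕ → EuclideanSpace ℝ (Fin d)} {t : ℕ}
    (hg : ‖g (t + 1)‖ ≤ B) {x : EuclideanSpace ℝ (Fin d)} (hx : ‖x‖ < 1) :
    (hessPhi d η β B g (t + 1) x - regGram d β g (t + 1)).PosSemidef := by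
  have hx' : 0 < 1 - ‖x‖ ^ 2 := by nlinarith [norm_nonneg x]
  have hη' : 0 ≤ η := by linarith
  have hgsq : ‖g (t + 1)‖ ^ 2 ≤ B ^ 2 := pow_le_pow_left₀ (norm_nonneg _) hg 2
  have h : hessPhi d η β B g (t + 1) x - regGram d β g (t + 1) =
      (2 * η * d / (1 - ‖x‖ ^ 2)) • (1 : Matrix (Fin d) (Fin d) ℝ)
      + (4 * η * d / (1 - ‖x‖ ^ 2) ^ 2) • outer x x
      + ((η * B ^ 2) • (1 : Matrix (Fin d) (Fin d) ℝ) - β • outer (g (t + 1)) (g (t + 1))) := by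
    rw [regGram_succ, hessPhi, hessPsi, regGram, add_tsub_cancel_right, add_smul]
    abel
  rw [h]
  refine ((PosSemidef.one.smul (by positivity)).add
    ((posSemidef_outer_self x).smul (by positivity))).add
    (posSemidef_smul_one_sub_smul_outer _ hβ.1.le ?_)
  nlinarith [mul_le_mul_of_nonneg_right hη (sq_nonneg B),
    mul_le_mul_of_nonneg_right hβ.2.le (sq_nonneg ‖g (t + 1)‖)]

/-- If `‖g_s‖ ≤ B` for all `1 ≤ s ≤ T`, then for any points `y_1, …, y_T` in the open unit
ball, `Σ_{t=1}^T g_tᵀ (∇²Φ_t(y_t))⁻¹ g_t ≤ (d/β)·ln(d + T·B²/d)`. -/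
theorem sum_local_grad_norms_le
    (d : ℕ) (hd : 1 ≤ d) (η β B : ℝ) (hη : 1 ≤ η) (hβ : β ∈ Set.Ioo (0 : ℝ) 1) (hB : 0 < B)
    (T : ℕ) (hT : 1 ≤ T) (g w : ℕ → EuclideanSpace ℝ (Fin d))
    (hw : ∀ s ∈ Icc 1 T, ‖w s‖ < 1)
    (hg : ∀ s ∈ Icc 1 T, ‖g s‖ ≤ B)
    (y : ℕ → EuclideanSpace ℝ (Fin d)) (hy : ∀ t ∈ Icc 1 T, ‖y t‖ < 1) :
    ∑ t ∈ Icc 1 T, qf (hessPhi d η β B g t (y t))⁻¹ (g t) ≤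
      (d / β) * Real.log (d + T * B ^ 2 / d) := by
  have hd' : (1 : ℝ) ≤ d := by exact_mod_cast hd
  have hstep : ∀ n ≤ T, ∑ t ∈ Icc 1 n, β * qf (hessPhi d η β B g t (y t))⁻¹ (g t) ≤
      Real.log (regGram d β g n).det - Real.log (regGram d β g 0).det := by
    intro n
    induction n with
    | zero => simp
    | succ n ih =>
      intro hn
      have hmem : n + 1 ∈ Icc 1 T := Finset.mem_Icc.mpr ⟨by omega, hn⟩
      have hsub : regGram d β g (n + 1) - β • vecMulVec (g (n + 1)).ofLp (g (n + 1)).ofLp =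
          regGram d β g n := by
        rw [regGram_succ, outer_eq_vecMulVec, add_sub_cancel_right]
      have hgrow := mul_dotProduct_inv_mulVec_le_log_det_sub (b := β) (v := (g (n + 1)).ofLp)
        (posDef_regGram hd hβ.1.le g (n + 1)) (hsub ▸ posDef_regGram hd hβ.1.le g n)
      rw [hsub] at hgrow
      have hinv := dotProduct_inv_mulVec_le (posDef_regGram hd hβ.1.le g (n + 1))
        (posSemidef_hessPhi_sub_regGram hη hβ (hg _ hmem) (hy _ hmem)) (g (n + 1)).ofLp
      rw [Finset.sum_Icc_succ_top (by omega), qf_eq_dotProduct]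
      linarith [ih (by omega), mul_le_mul_of_nonneg_left hinv hβ.1.le]
  have hlog₀ : Real.log (regGram d β g 0).det = d * Real.log d := by
    simp [regGram_zero]
  have harg : 0 < d + T * B ^ 2 / d := by positivity
  have hsum : ∑ s ∈ Icc 1 T, ‖g s‖ ^ 2 ≤ T * B ^ 2 := by
    simpa using Finset.sum_le_card_nsmul (Icc 1 T) (fun s => ‖g s‖ ^ 2) (B ^ 2)
      fun s hs => pow_le_pow_left₀ (norm_nonneg _) (hg s hs) 2
  have htr : (regGram d β g T).trace ≤ Fintype.card (Fin d) * (d * (d + T * B ^ 2 / d)) := by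
    rw [trace_regGram, Fintype.card_fin]
    have hS : 0 ≤ ∑ s ∈ Icc 1 T, ‖g s‖ ^ 2 := Finset.sum_nonneg fun s _ => sq_nonneg _
    have hmul : (d : ℝ) * (d + T * B ^ 2 / d) = d * d + T * B ^ 2 := by field_simp
    rw [hmul]
    have hβS := mul_le_mul_of_nonneg_right hβ.2.le hS
    have hTB : (0 : ℝ) ≤ d * d + T * B ^ 2 := by positivity
    linarith [mul_le_mul_of_nonneg_right hd' hTB]
  have hlogT := log_det_le_of_trace_le (posDef_regGram hd hβ.1.le g T) (by positivity) htr
  rw [Fintype.card_fin, Real.log_mul (by positivity) harg.ne', mul_add] at hlogT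
  have hfin := hstep T le_rfl
  rw [← Finset.mul_sum, hlog₀] at hfin
  rw [div_mul_eq_mul_div, le_div_iff₀ hβ.1, mul_comm]
  linarith
end
end

section
/- Assume ‖g_s‖ ≤ B for all 1 ≤ s ≤ T. Let 1 ≤ t ≤ T+1, C > 0, let x_t be the minimizer of Φ_t over int B(1), and let u ∈ int B(1) satisfy (u−x_t)ᵀ∇²Ψ(u)(u−x_t) ≤ ηC², where ∇²Ψ(u) = 2ηd·( I/(1−‖u‖²) + 2uuᵀ/(1−‖u‖²)² ). Then the gradient of Φ_t at u satisfies ‖∇Φ_t(u)‖ ≤ (4 + 2C)·(2ηd + B²η + (B + 2βB²)(t−1)). -/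
open Finset
open scoped InnerProductSpace

noncomputable section

/-- The gradient of `R(x) = (β/2)·Σ_{s ∈ S} ⟪g_s, x−w_s⟫² + ⟪x, Σ_{s ∈ S} g_s⟫`. -/
def lossGrad {d : ℕ} (β : ℝ) (g w : ℕ → EuclideanSpace ℝ (Fin d)) (S : Finset ℕ)
    (x : EuclideanSpace ℝ (Fin d)) : EuclideanSpace ℝ (Fin d) :=
  ∑ s ∈ S, (β * ⟪g s, x - w s⟫_ℝ + 1) • g s

theorem norm_lossGrad_le {d : ℕ} {β B : ℝ} (hβ : 0 ≤ β)
    {g w : ℕ → EuclideanSpace ℝ (Fin d)} {S : Finset ℕ}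
    (hw : ∀ s ∈ S, ‖w s‖ ≤ 1) (hg : ∀ s ∈ S, ‖g s‖ ≤ B)
    {x : EuclideanSpace ℝ (Fin d)} (hx : ‖x‖ ≤ 1) :
    ‖lossGrad β g w S x‖ ≤ (B + 2 * β * B ^ 2) * #S := by
  have hterm : ∀ s ∈ S, ‖(β * ⟪g s, x - w s⟫_ℝ + 1) • g s‖ ≤ B + 2 * β * B ^ 2 := by
    intro s hs
    have hB : 0 ≤ B := (norm_nonneg _).trans (hg s hs)
    have hxw : ‖x - w s‖ ≤ 2 := (norm_sub_le _ _).trans (by linarith [hw s hs])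
    have hinner : |⟪g s, x - w s⟫_ℝ| ≤ B * 2 :=
      (abs_real_inner_le_norm _ _).trans
        (mul_le_mul (hg s hs) hxw (norm_nonneg _) hB)
    have hcoef : |β * ⟪g s, x - w s⟫_ℝ + 1| ≤ β * (B * 2) + 1 := by
      refine (abs_add_le _ _).trans ?_
      rw [abs_mul, abs_of_nonneg hβ, abs_one]
      gcongr
    rw [norm_smul, Real.norm_eq_abs]
    calc _ ≤ (β * (B * 2) + 1) * B :=
          mul_le_mul hcoef (hg s hs) (norm_nonneg _) (by positivity)
      _ = _ := by ring
  calc _ ≤ ∑ _s ∈ S, (B + 2 * β * B ^ 2) := norm_sum_le_of_le S hterm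
    _ = _ := by rw [sum_const, nsmul_eq_mul, mul_comm]

theorem hasGradientAt_Phi {d : ℕ} {η β B : ℝ} {g w : ℕ → EuclideanSpace ℝ (Fin d)} {t : ℕ}
    {x : EuclideanSpace ℝ (Fin d)} (hx : ‖x‖ < 1) :
    HasGradientAt (Phi d η β B g w t)
      ((2 * η * d / (1 - ‖x‖ ^ 2) + (d + B ^ 2 * η)) • x
        + lossGrad β g w (Icc 1 (t - 1)) x) x := by
  have ha : 1 - ‖x‖ ^ 2 ≠ 0 := by nlinarith [norm_nonneg x]
  have hsq : HasFDerivAt (fun y : EuclideanSpace ℝ (Fin d) => ‖y‖ ^ 2) (2 • innerSL ℝ x) x :=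
    (hasStrictFDerivAt_norm_sq x).hasFDerivAt
  have hlog := ((hsq.const_sub 1).log ha).const_mul (-(η * d))
  have hquad := hsq.const_mul ((d + B ^ 2 * η) / 2)
  have hloss := (HasFDerivAt.fun_sum (u := Icc 1 (t - 1)) fun s _ =>
    (((innerSL ℝ (g s)).hasFDerivAt (x := x - w s)).comp x
      ((hasFDerivAt_id x).sub_const (w s))).pow 2).const_mul (β / 2)
  have hlin := (innerSL ℝ (∑ s ∈ Icc 1 (t - 1), g s)).hasFDerivAt (x := x)
  rw [hasGradientAt_iff_hasFDerivAt]
  have h := ((hlog.add hquad).add hloss).add hlin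
  refine (h.congr_of_eventuallyEq (.of_forall fun y => ?_)).congr_fderiv ?_
  · simp [Phi, Psi, real_inner_comm, inner_sum]
  · ext v
    simp [lossGrad, mul_sum, add_mul, sum_add_distrib, inner_sub_right]
    field_simp
    ring

theorem qf_hessPsi {d : ℕ} (η : ℝ) (u v : EuclideanSpace ℝ (Fin d)) :
    qf (hessPsi d η u) v = 2 * η * d / (1 - ‖u‖ ^ 2) * ‖v‖ ^ 2
      + 4 * η * d / (1 - ‖u‖ ^ 2) ^ 2 * ⟪u, v⟫_ℝ ^ 2 := by
  have hnorm : ‖v‖ ^ 2 = ∑ i, ∑ j, v i * (1 : Matrix (Fin d) (Fin d) ℝ) i j * v j := by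
    simp [EuclideanSpace.real_norm_sq_eq, Matrix.one_apply, ← sq]
  have hinner : ⟪u, v⟫_ℝ ^ 2 = ∑ i, ∑ j, v i * outer u u i j * v j := by
    rw [sq, PiLp.inner_apply, sum_mul_sum]
    refine sum_congr rfl fun i _ => sum_congr rfl fun j _ => ?_
    simp [outer]
    ring
  rw [hnorm, hinner, mul_sum, mul_sum, ← sum_add_distrib, qf]
  refine sum_congr rfl fun i _ => ?_
  rw [mul_sum, mul_sum, ← sum_add_distrib]
  refine sum_congr rfl fun j _ => ?_
  simp [hessPsi]
  ring

/-- A point at local `∇²Ψ(u)`-distance `√η·C` from `u` is at most `1 + C` times farther from the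
unit sphere, as measured by `1 − ‖·‖²`. -/
theorem one_sub_norm_sq_le_of_qf_hessPsi_le {d : ℕ} (hd : 1 ≤ d) {η C : ℝ} (hη : 0 < η)
    (hC : 0 ≤ C) {u x : EuclideanSpace ℝ (Fin d)} (hu : ‖u‖ < 1)
    (hclose : qf (hessPsi d η u) (u - x) ≤ η * C ^ 2) :
    1 - ‖x‖ ^ 2 ≤ (1 + C) * (1 - ‖u‖ ^ 2) := by
  have ha : 0 < 1 - ‖u‖ ^ 2 := by nlinarith [norm_nonneg u]
  have hd' : (1 : ℝ) ≤ d := by exact_mod_cast hd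
  have hx : ‖x‖ ^ 2 = ‖u‖ ^ 2 - 2 * ⟪u, u - x⟫_ℝ + ‖u - x‖ ^ 2 := by
    rw [← norm_sub_sq_real, sub_sub_cancel]
  rw [qf_hessPsi] at hclose
  generalize ⟪u, u - x⟫_ℝ = p at *
  set a := 1 - ‖u‖ ^ 2 with ha_def
  have hp : (2 * p) ^ 2 ≤ (C * a) ^ 2 := by
    have h1 : 0 ≤ 2 * η * d / a * ‖u - x‖ ^ 2 := by positivity
    have h2 : η * ((2 * p) ^ 2 / a ^ 2) ≤ η * C ^ 2 := by
      calc η * ((2 * p) ^ 2 / a ^ 2) = 1 * (4 * η * p ^ 2 / a ^ 2) := by ring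
        _ ≤ d * (4 * η * p ^ 2 / a ^ 2) := by gcongr
        _ = 4 * η * d / a ^ 2 * p ^ 2 := by ring
        _ ≤ _ := by linarith
    have h3 := le_of_mul_le_mul_left h2 hη
    rw [div_le_iff₀ (by positivity)] at h3
    rwa [mul_pow C]
  have hp' := abs_le_of_sq_le_sq' hp (by positivity)
  nlinarith [hp'.2, sq_nonneg ‖u - x‖]

/-- Lemma 9 of the paper (gradient bound): if `x_t` minimizes `Φ_t` over the open unit ball
and `u` in the open unit ball satisfies `(u−x_t)ᵀ∇²Ψ(u)(u−x_t) ≤ ηC²`, then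
`‖∇Φ_t(u)‖ ≤ (4 + 2C)·(2ηd + B²η + (B + 2βB²)(t−1))`. -/
theorem grad_Phi_norm_le
    (d : ℕ) (hd : 1 ≤ d) (η β B : ℝ) (hη : 1 ≤ η) (hβ : β ∈ Set.Ioo (0 : ℝ) 1) (hB : 0 < B)
    (T : ℕ) (hT : 1 ≤ T) (g w : ℕ → EuclideanSpace ℝ (Fin d))
    (hw : ∀ s ∈ Icc 1 T, ‖w s‖ < 1)
    (hg : ∀ s ∈ Icc 1 T, ‖g s‖ ≤ B)
    (t : ℕ) (ht : t ∈ Icc 1 (T + 1)) (C : ℝ) (hC : 0 < C)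
    (x : EuclideanSpace ℝ (Fin d))
    (hxball : x ∈ Metric.ball (0 : EuclideanSpace ℝ (Fin d)) 1)
    (hxmin : IsMinOn (Phi d η β B g w t) (Metric.ball (0 : EuclideanSpace ℝ (Fin d)) 1) x)
    (u : EuclideanSpace ℝ (Fin d)) (hu : ‖u‖ < 1)
    (hclose : qf (hessPsi d η u) (u - x) ≤ η * C ^ 2) :
    ‖gradient (Phi d η β B g w t) u‖ ≤
      (4 + 2 * C) * (2 * η * d + B ^ 2 * η + (B + 2 * β * B ^ 2) * ((t : ℝ) - 1)) := by
  have hd' : (1 : ℝ) ≤ d := by exact_mod_cast hd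
  have hx : ‖x‖ < 1 := by simpa using hxball
  obtain ⟨ht1, htT⟩ := mem_Icc.mp ht
  have hsub : ∀ s ∈ Icc 1 (t - 1), s ∈ Icc 1 T := by
    intro s hs
    simp only [mem_Icc] at hs ⊢
    omega
  have hloss {y : EuclideanSpace ℝ (Fin d)} (hy : ‖y‖ < 1) :
      ‖lossGrad β g w (Icc 1 (t - 1)) y‖ ≤ (B + 2 * β * B ^ 2) * ((t : ℝ) - 1) := by
    have h := norm_lossGrad_le hβ.1.le (fun s hs => (hw s (hsub s hs)).le)
      (fun s hs => hg s (hsub s hs)) hy.le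
    rwa [Nat.card_Icc, Nat.add_sub_cancel, Nat.cast_sub ht1, Nat.cast_one] at h
  have hcrit : (2 * η * d / (1 - ‖x‖ ^ 2) + (d + B ^ 2 * η)) • x
      + lossGrad β g w (Icc 1 (t - 1)) x = 0 := by
    have hmin := hxmin.isLocalMin (Metric.isOpen_ball.mem_nhds hxball)
    have h := hmin.hasFDerivAt_eq_zero (hasGradientAt_Phi hx).hasFDerivAt
    exact (InnerProductSpace.toDual ℝ _).map_eq_zero_iff.mp h
  have hxM := hloss hx
  have huM := hloss hu
  rw [(hasGradientAt_Phi hu).gradient]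
  have ha : 0 < 1 - ‖u‖ ^ 2 := by nlinarith [norm_nonneg u]
  have hb : 0 < 1 - ‖x‖ ^ 2 := by nlinarith [norm_nonneg x]
  have hη0 : 0 < η := by linarith
  have hab := one_sub_norm_sq_le_of_qf_hessPsi_le hd hη0 hC.le hu hclose
  set M := (B + 2 * β * B ^ 2) * ((t : ℝ) - 1)
  have hM : 0 ≤ M := (norm_nonneg _).trans hxM
  have hxnorm : 2 * η * d / (1 - ‖x‖ ^ 2) * ‖x‖ ≤ M := by
    rw [← norm_neg, ← eq_neg_of_add_eq_zero_left hcrit, norm_smul, Real.norm_eq_abs,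
      abs_of_nonneg (by positivity)] at hxM
    refine le_trans ?_ hxM
    gcongr
    linarith [show 0 ≤ d + B ^ 2 * η by positivity]
  have hxinv : 2 * η * d / (1 - ‖x‖ ^ 2) ≤ 2 * η * d + M := by
    refine le_trans ?_ (add_le_add_right hxnorm _)
    rw [div_mul_eq_mul_div, ← sub_le_iff_le_add, ← sub_div, ← mul_one_sub,
      div_le_iff₀ hb]
    gcongr
    nlinarith [norm_nonneg x]
  have huinv : 2 * η * d / (1 - ‖u‖ ^ 2) ≤ (1 + C) * (2 * η * d + M) := by
    calc _ ≤ (1 + C) * (2 * η * d / (1 - ‖x‖ ^ 2)) := by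
          rw [← mul_div_assoc, div_le_div_iff₀ ha hb]
          nlinarith [mul_le_mul_of_nonneg_left hab (show 0 ≤ 2 * η * d by positivity)]
      _ ≤ _ := by gcongr
  have hnorm : ‖(2 * η * d / (1 - ‖u‖ ^ 2) + (d + B ^ 2 * η)) • u‖ ≤
      (1 + C) * (2 * η * d + M) + (d + B ^ 2 * η) := by
    rw [norm_smul, Real.norm_eq_abs, abs_of_nonneg (by positivity)]
    refine (mul_le_of_le_one_right (by positivity) hu.le).trans ?_
    gcongr
  have hηd : (d : ℝ) ≤ 2 * η * d := by nlinarith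
  have hBη : 0 ≤ B ^ 2 * η := by positivity
  refine (norm_add_le _ _).trans ((add_le_add hnorm huM).trans ?_)
  have hCη : 0 ≤ C * (2 * η * d + M) := by positivity
  have hCB : 0 ≤ C * (B ^ 2 * η) := by positivity
  have hηd0 : 0 ≤ 2 * η * d := by positivity
  linarith
end
end
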